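/- Grant the compatibility condition ζ ≤ √(2⌊K/2⌋)/(4K). There exist constants c=c(K)>0 and ε₀>0 such that whenever ε≤ε₀, δ≤1/6 and L≤1/3, then for every n, δ, ε, ζ: the infimum over all estimators ψ̂₁ (measurable functions of (Y₁,…,Yₙ) with values in ℝ^K) of sup over (φ,ψ)∈Φ_L(δ,ε,ζ) of P_{(φ,ψ)}( ‖ψ̂₁−ψ₁‖² ≥ c/n ) is at least 1/4. -/

import Mathlib

open scoped BigOperators

namespace PaperHMM

/-- Parameter of a two-state HMM with multinomial emissions on `Fin K`. -/
structure Param (K : ℕ) where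
  p : ℝ
  q : ℝ
  f0 : Fin K → ℝ
  f1 : Fin K → ℝ

/-- `f` is a probability density with respect to counting measure on `Fin K`. -/
def IsDensity {K : ℕ} (f : Fin K → ℝ) : Prop :=
  (∀ k, 0 ≤ f k) ∧ ∑ k, f k = 1

/-- Validity of HMM parameters: `p, q ∈ (0,1)` and emission densities. -/
def Valid {K : ℕ} (θ : Param K) : Prop :=
  θ.p ∈ Set.Ioo (0 : ℝ) 1 ∧ θ.q ∈ Set.Ioo (0 : ℝ) 1 ∧
    IsDensity θ.f0 ∧ IsDensity θ.f1

/-- Euclidean norm of a finitely supported real function. -/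
noncomputable def enormF {α : Type*} [Fintype α] (g : α → ℝ) : ℝ :=
  Real.sqrt (∑ a, (g a) ^ 2)

/-- Stationary initial distribution of the hidden chain: `P(X₁=0)=q/(p+q)`. -/
noncomputable def initD {K : ℕ} (θ : Param K) : Fin 2 → ℝ :=
  fun a => if a = 0 then θ.q / (θ.p + θ.q) else θ.p / (θ.p + θ.q)

/-- Transition matrix `Q = [[1-p, p], [q, 1-q]]` of the hidden chain. -/
noncomputable def transP {K : ℕ} (θ : Param K) : Fin 2 → Fin 2 → ℝ :=
  fun a b =>
    if a = 0 then (if b = 0 then 1 - θ.p else θ.p)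
    else (if b = 0 then θ.q else 1 - θ.q)

/-- Emission densities indexed by the hidden state. -/
def emit {K : ℕ} (θ : Param K) : Fin 2 → Fin K → ℝ :=
  fun a => if a = 0 then θ.f0 else θ.f1

/-- The probability mass function `p_θ^{(n)}` of the first `n` observations
`(Y₁,…,Yₙ)`:  `∑_{x ∈ {0,1}ⁿ} P(X₁=x₁) ∏_{i<n} Q_{x_i,x_{i+1}} ∏_{i≤n} f_{x_i}(y_i)`. -/
noncomputable def pLaw {K : ℕ} (θ : Param K) (n : ℕ) (y : Fin n → Fin K) : ℝ :=
  ∑ x : Fin n → Fin 2,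
    (∏ i : Fin n,
        (if (i : ℕ) = 0 then initD θ (x i)
          else transP θ (x ⟨(i : ℕ) - 1, lt_of_le_of_lt (Nat.sub_le _ _) i.isLt⟩) (x i)))
      * ∏ i : Fin n, emit θ (x i) (y i)

open Classical in
/-- Probability under `P_θ` that `(Y₁,…,Yₙ)` lies in the event `E`. -/
noncomputable def probOf {K : ℕ} (θ : Param K) (n : ℕ)
    (E : (Fin n → Fin K) → Prop) : ℝ :=
  ∑ y : Fin n → Fin K, if E y then pLaw θ n y else 0

/-- The parameter class `Θ(δ,ε,ζ)`. -/
def ThetaSet (K : ℕ) (δ ε ζ : ℝ) : Set (Param K) :=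
  {θ | Valid θ ∧ δ ≤ θ.p ∧ δ ≤ θ.q ∧ ε ≤ |1 - θ.p - θ.q| ∧
    ζ ≤ enormF (fun k => θ.f0 k - θ.f1 k)}

/-- The parameter class `Θ_L(δ,ε,ζ)`. -/
def ThetaL (K : ℕ) (L δ ε ζ : ℝ) : Set (Param K) :=
  ThetaSet K δ ε ζ ∩ {θ | L ≤ 1 - |1 - θ.p - θ.q|}

/-- The reparametrised pair `(φ, ψ)`: scalar parameters `φ = (φ₁,φ₂,φ₃)` and
vector parameters `ψ = (ψ₁, ψ₂)`. -/
abbrev PP (K : ℕ) := (ℝ × ℝ × ℝ) × ((Fin K → ℝ) × (Fin K → ℝ))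

/-- `φ(θ) = ((q-p)/(p+q), 1-p-q, ‖f₀-f₁‖)`. -/
noncomputable def phiOf {K : ℕ} (θ : Param K) : ℝ × ℝ × ℝ :=
  ((θ.q - θ.p) / (θ.p + θ.q), 1 - θ.p - θ.q,
    enormF (fun k => θ.f0 k - θ.f1 k))

/-- `ψ(θ) = ((q f₀ + p f₁)/(p+q), (f₀-f₁)/‖f₀-f₁‖)`. -/
noncomputable def psiOf {K : ℕ} (θ : Param K) : (Fin K → ℝ) × (Fin K → ℝ) :=
  (fun k => (θ.q * θ.f0 k + θ.p * θ.f1 k) / (θ.p + θ.q),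
    fun k => (θ.f0 k - θ.f1 k) / enormF (fun j => θ.f0 j - θ.f1 j))

/-- The map `θ ↦ (φ(θ), ψ(θ))`. -/
noncomputable def pack {K : ℕ} (θ : Param K) : PP K := (phiOf θ, psiOf θ)

/-- The inverse parametrisation `θ(φ,ψ)`:
`p = ½(1-φ₂)(1-φ₁)`, `q = ½(1-φ₂)(1+φ₁)`,
`f₀ = ψ₁ - ½φ₁φ₃ψ₂ + ½φ₃ψ₂`, `f₁ = ψ₁ - ½φ₁φ₃ψ₂ - ½φ₃ψ₂`. -/
noncomputable def unpack {K : ℕ} (π : PP K) : Param K where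
  p := (1 - π.1.2.1) * (1 - π.1.1) / 2
  q := (1 - π.1.2.1) * (1 + π.1.1) / 2
  f0 := fun k => π.2.1 k - π.1.1 * π.1.2.2 * π.2.2 k / 2 + π.1.2.2 * π.2.2 k / 2
  f1 := fun k => π.2.1 k - π.1.1 * π.1.2.2 * π.2.2 k / 2 - π.1.2.2 * π.2.2 k / 2

/-- `Φ(δ,ε,ζ)`. -/
def PhiSet (K : ℕ) (δ ε ζ : ℝ) : Set (PP K) := pack '' ThetaSet K δ ε ζ

/-- `Φ_L(δ,ε,ζ)`. -/
def PhiL (K : ℕ) (L δ ε ζ : ℝ) : Set (PP K) := pack '' ThetaL K L δ ε ζ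

/-- `⋃_{δ,ε,ζ} Φ(δ,ε,ζ)`. -/
def PhiAll (K : ℕ) : Set (PP K) :=
  ⋃ (δ ∈ Set.Ioo (0 : ℝ) 1) (ε ∈ Set.Ioo (0 : ℝ) 1) (ζ ∈ Set.Ioi (0 : ℝ)),
    PhiSet K δ ε ζ

/-- `r(φ) = ¼ (1-φ₁²) φ₂ φ₃²`. -/
noncomputable def rfun (φ : ℝ × ℝ × ℝ) : ℝ :=
  (1 - φ.1 ^ 2) * φ.2.1 * φ.2.2 ^ 2 / 4

/-- `m(φ) = (r(φ), φ₂ r(φ), φ₁ φ₂ φ₃ r(φ))`. -/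
noncomputable def mvec (φ : ℝ × ℝ × ℝ) : ℝ × ℝ × ℝ :=
  (rfun φ, φ.2.1 * rfun φ, φ.1 * φ.2.1 * φ.2.2 * rfun φ)

/-- Sign function with the convention `sgn 0 = +1`. -/
noncomputable def sgn (t : ℝ) : ℝ := if t < 0 then -1 else 1

/-- The statistical distance `ρ((φ,ψ);(φ̃,ψ̃))`. -/
noncomputable def rho {K : ℕ} (π π' : PP K) : ℝ :=
  max (max (max (max
    |(mvec π.1).1 - (mvec π'.1).1|
    |(mvec π.1).2.1 - (mvec π'.1).2.1|)
    |(mvec π.1).2.2 - sgn (∑ k, π.2.2 k * π'.2.2 k) * (mvec π'.1).2.2|)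
    (enormF fun k => π.2.1 k - π'.2.1 k))
    ((max |(mvec π.1).1| |(mvec π'.1).1|) *
      enormF fun k => π.2.2 k - sgn (∑ j, π.2.2 j * π'.2.2 j) * π'.2.2 k)

/-- `p^{(3)}_{φ,ψ} = p^{(3)}_{θ(φ,ψ)}`, the law of three consecutive observations. -/
noncomputable def p3 {K : ℕ} (π : PP K) : (Fin 3 → Fin K) → ℝ :=
  pLaw (unpack π) 3

/-- The empirical estimator `p̂ₙ^{(3)}(a,b,c) = n⁻¹ ∑_{i=1}^{n-2} 1{Yᵢ=a, Y_{i+1}=b, Y_{i+2}=c}`. -/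
noncomputable def empP3 {K : ℕ} (n : ℕ) (y : Fin n → Fin K)
    (v : Fin 3 → Fin K) : ℝ :=
  (n : ℝ)⁻¹ * ∑ i : Fin n,
    if h : (i : ℕ) + 2 < n then
      (if y i = v 0 ∧ y ⟨(i : ℕ) + 1, by omega⟩ = v 1 ∧ y ⟨(i : ℕ) + 2, h⟩ = v 2
        then 1 else 0)
    else 0

/-- Kullback–Leibler divergence `K(P;Q) = ∑_y P(y) log(P(y)/Q(y))` between
probability mass functions on `(Fin K)ⁿ`. -/
noncomputable def klDiv {K : ℕ} (n : ℕ) (P Q : (Fin n → Fin K) → ℝ) : ℝ :=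
  ∑ y : Fin n → Fin K, P y * Real.log (P y / Q y)


/-- Weight of a hidden path. -/
noncomputable def wt {K : ℕ} (θ : Param K) (n : ℕ) (x : Fin n → Fin 2) : ℝ :=
  ∏ i : Fin n,
        (if (i : ℕ) = 0 then initD θ (x i)
          else transP θ (x ⟨(i : ℕ) - 1, lt_of_le_of_lt (Nat.sub_le _ _) i.isLt⟩) (x i))

lemma wt_nonneg {K : ℕ} (θ : Param K) (h : Valid θ) (n : ℕ) (x : Fin n → Fin 2) :
    0 ≤ wt θ n x := by
  obtain ⟨⟨hp0, hp1⟩, ⟨hq0, hq1⟩, -, -⟩ := h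
  refine Finset.prod_nonneg fun i _ => ?_
  unfold initD transP
  split_ifs <;> first | positivity | linarith

lemma initD_sum {K : ℕ} (θ : Param K) (h : Valid θ) : ∑ a, initD θ a = 1 := by
  obtain ⟨⟨hp0, hp1⟩, ⟨hq0, hq1⟩, -, -⟩ := h
  have : θ.p + θ.q ≠ 0 := by positivity
  simp [initD, Fin.sum_univ_two]
  field_simp
  ring

lemma transP_sum {K : ℕ} (θ : Param K) (b : Fin 2) : ∑ a, transP θ b a = 1 := by
  simp only [transP, Fin.sum_univ_two]
  split_ifs <;> simp_all

lemma wt_sum {K : ℕ} (θ : Param K) (h : Valid θ) (n : ℕ) :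
    ∑ x, wt θ n x = 1 := by
  induction n with
  | zero => simp [wt]
  | succ n ih =>
    rw [← (Fin.snocEquiv (fun _ : Fin (n+1) => Fin 2)).sum_comp, Fintype.sum_prod_type_right]
    rw [← ih]
    refine Finset.sum_congr rfl fun x _ => ?_
    have key : ∀ a : Fin 2, wt θ (n+1) (Fin.snoc x a : Fin (n+1) → Fin 2) = wt θ n x *
        (if hn : n = 0 then initD θ a else transP θ (x ⟨n - 1, by omega⟩) a) := by
      intro a
      unfold wt
      rw [Fin.prod_univ_castSucc]
      congr 1
      · refine Finset.prod_congr rfl fun i _ => ?_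
        have e : (⟨(i : ℕ) - 1, by omega⟩ : Fin (n+1)) = Fin.castSucc ⟨(i:ℕ) - 1, by omega⟩ := rfl
        simp only [Fin.val_castSucc, Fin.snoc_castSucc]
        rw [e, Fin.snoc_castSucc]
      · by_cases hn : n = 0
        · simp [hn]
        · have e : (⟨n - 1, by omega⟩ : Fin (n+1)) = Fin.castSucc ⟨n - 1, by omega⟩ := rfl
          simp only [Fin.val_last, Fin.snoc_last, hn, if_false, dif_neg, not_false_eq_true]
          rw [e, Fin.snoc_castSucc]
    have : ∀ a : Fin 2, wt θ (n+1) ((Fin.snocEquiv (fun _ : Fin (n+1) => Fin 2)) (a, x)) =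
      wt θ n x *
        (if hn : n = 0 then initD θ a else transP θ (x ⟨n - 1, by omega⟩) a) := key
    simp only [this]
    rw [← Finset.mul_sum]
    split_ifs with hn
    · rw [initD_sum θ h, mul_one]
    · rw [transP_sum, mul_one]

lemma pLaw_eq {K : ℕ} (θ : Param K) (n : ℕ) (y : Fin n → Fin K) :
    pLaw θ n y = ∑ x, wt θ n x * ∏ i, emit θ (x i) (y i) := rfl

lemma sum_pi {K n : ℕ} (g : Fin n → Fin K → ℝ) :
    ∑ y : Fin n → Fin K, ∏ i, g i (y i) = ∏ i, ∑ k, g i k := by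
  rw [Finset.prod_univ_sum, Fintype.piFinset_univ]

lemma emit_density {K : ℕ} (θ : Param K) (h : Valid θ) (a : Fin 2) : IsDensity (emit θ a) := by
  unfold emit
  split_ifs
  · exact h.2.2.1
  · exact h.2.2.2

lemma pLaw_nonneg {K : ℕ} (θ : Param K) (h : Valid θ) (n : ℕ) (y : Fin n → Fin K) :
    0 ≤ pLaw θ n y := by
  rw [pLaw_eq]
  exact Finset.sum_nonneg fun x _ => mul_nonneg (wt_nonneg θ h n x)
    (Finset.prod_nonneg fun i _ => (emit_density θ h _).1 _)

lemma pLaw_sum {K : ℕ} (θ : Param K) (h : Valid θ) (n : ℕ) :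
    ∑ y, pLaw θ n y = 1 := by
  simp only [pLaw_eq]
  rw [Finset.sum_comm, ← wt_sum θ h n]
  refine Finset.sum_congr rfl fun x _ => ?_
  rw [← Finset.mul_sum, sum_pi (fun i => emit θ (x i))]
  simp [(emit_density θ h _).2]

lemma probOf_le_one {K : ℕ} (θ : Param K) (h : Valid θ) (n : ℕ)
    (E : (Fin n → Fin K) → Prop) : probOf θ n E ≤ 1 := by
  rw [← pLaw_sum θ h n]
  refine Finset.sum_le_sum fun y _ => ?_
  split_ifs
  · exact le_rfl
  · exact pLaw_nonneg θ h n y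

lemma unpack_pack {K : ℕ} (θ : Param K) (h : Valid θ)
    (hf : 0 < enormF (fun k => θ.f0 k - θ.f1 k)) : unpack (pack θ) = θ := by
  obtain ⟨⟨hp0, hp1⟩, ⟨hq0, hq1⟩, -, -⟩ := h
  have hpq : θ.p + θ.q ≠ 0 := by positivity
  obtain ⟨p, q, f0, f1⟩ := θ
  simp only [unpack, pack, phiOf, psiOf, Param.mk.injEq] at *
  have hf' := hf.ne'
  generalize enormF (fun k => f0 k - f1 k) = N at *
  refine ⟨?_, ?_, ?_, ?_⟩
  · field_simp; ring
  · field_simp; ring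
  · funext k; field_simp; ring
  · funext k; field_simp; ring

/-- Two point function. -/
noncomputable def tp (K : ℕ) (a b : ℝ) : Fin K → ℝ :=
  fun k => if (k : ℕ) = 0 then a else if (k : ℕ) = 1 then b else 0

lemma tp_sum {K : ℕ} (hK : 2 ≤ K) (a b : ℝ) : ∑ k, tp K a b k = a + b := by
  obtain ⟨m, rfl⟩ := Nat.exists_eq_add_of_le' hK
  rw [Fin.sum_univ_succ, Fin.sum_univ_succ]
  simp [tp]

/-- The test parameters. -/
noncomputable def th (K : ℕ) (t : ℝ) : Param K :=
  ⟨1/4, 1/4, tp K (3/4 + t) (1/4 - t), tp K (1/4 + t) (3/4 - t)⟩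

lemma tp_density {K : ℕ} (hK : 2 ≤ K) (a b : ℝ) (ha : 0 ≤ a) (hb : 0 ≤ b) (hab : a + b = 1) :
    IsDensity (tp K a b) := by
  refine ⟨fun k => ?_, by rw [tp_sum hK, hab]⟩
  unfold tp
  split_ifs <;> first | assumption | exact le_rfl

lemma th_valid {K : ℕ} (hK : 2 ≤ K) (t : ℝ) (h0 : 0 ≤ t) (h1 : t ≤ 1/8) : Valid (th K t) := by
  refine ⟨⟨by norm_num [th], by norm_num [th]⟩, ⟨by norm_num [th], by norm_num [th]⟩, ?_, ?_⟩
  · exact tp_density hK _ _ (by linarith) (by linarith) (by ring)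
  · exact tp_density hK _ _ (by linarith) (by linarith) (by ring)

lemma th_norm {K : ℕ} (hK : 2 ≤ K) (t : ℝ) :
    enormF (fun k => (th K t).f0 k - (th K t).f1 k) = Real.sqrt (1/2) := by
  unfold enormF
  congr 1
  have : ∀ k, ((th K t).f0 k - (th K t).f1 k) ^ 2 = tp K (1/4) (1/4) k := by
    intro k
    simp only [th, tp]
    split_ifs <;> ring
  simp only [this]
  rw [tp_sum hK]; norm_num

lemma th_mem {K : ℕ} (hK : 2 ≤ K) (t : ℝ) (h0 : 0 ≤ t) (h1 : t ≤ 1/8) (L δ ε ζ : ℝ)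
    (hL : L ≤ 1/3) (hδ : δ ≤ 1/6) (hε : ε ≤ 1/2)
    (hζ : ζ ≤ Real.sqrt (2 * ((K / 2 : ℕ) : ℝ)) / (4 * K)) :
    th K t ∈ ThetaL K L δ ε ζ := by
  refine ⟨⟨th_valid hK t h0 h1, ?_, ?_, ?_, ?_⟩, ?_⟩
  · simp only [th]; linarith
  · simp only [th]; linarith
  · simp only [th]; norm_num [abs_of_pos]; linarith
  · rw [th_norm hK]
    refine hζ.trans ?_
    have hK' : (2:ℝ) ≤ K := by exact_mod_cast hK
    have h2 : (2 * ((K / 2 : ℕ) : ℝ)) ≤ K := by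
      have : 2 * (K / 2) ≤ K := Nat.mul_div_le K 2
      exact_mod_cast this
    rw [div_le_iff₀ (by positivity)]
    have : (4 * (K:ℝ)) = Real.sqrt ((4 * K)^2) := by rw [Real.sqrt_sq (by positivity)]
    rw [this, ← Real.sqrt_mul (by norm_num)]
    apply Real.sqrt_le_sqrt
    nlinarith
  · simp only [th, Set.mem_setOf_eq]; norm_num [abs_of_pos]; linarith

/-- Density ratio. -/
noncomputable def rat (K : ℕ) (t : ℝ) (a : Fin 2) : Fin K → ℝ :=
  if a = 0 then tp K (1 + 4*t/3) (1 - 4*t) else tp K (1 + 4*t) (1 - 4*t/3)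

lemma emit_th (K : ℕ) (t : ℝ) (a : Fin 2) (k : Fin K) :
    emit (th K t) a k = emit (th K 0) a k * rat K t a k := by
  simp only [emit, th, rat]
  split_ifs <;> simp only [tp] <;> split_ifs <;> ring

lemma emit_rat_sq {K : ℕ} (hK : 2 ≤ K) (t : ℝ) (a : Fin 2) :
    ∑ k, emit (th K 0) a k * rat K t a k ^ 2 = 1 + 16 / 3 * t ^ 2 := by
  by_cases ha : a = 0
  · have : ∀ k, emit (th K 0) a k * rat K t a k ^ 2 =
        tp K (3/4 * (1 + 4*t/3)^2) (1/4 * (1-4*t)^2) k := by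
      intro k
      simp only [emit, th, rat, ha, if_true, tp]
      split_ifs <;> ring
    simp only [this]
    rw [tp_sum hK]; ring
  · have : ∀ k, emit (th K 0) a k * rat K t a k ^ 2 =
        tp K (1/4 * (1 + 4*t)^2) (3/4 * (1-4*t/3)^2) k := by
      intro k
      simp only [emit, th, rat, ha, if_false, tp]
      split_ifs <;> ring
    simp only [this]
    rw [tp_sum hK]; ring

lemma wt_th (K n : ℕ) (t : ℝ) (x : Fin n → Fin 2) : wt (th K t) n x = wt (th K 0) n x := rfl

lemma cond_l1 {K : ℕ} (hK : 2 ≤ K) (n : ℕ) (t : ℝ) (h0 : 0 ≤ t) (h1 : t ≤ 1/8)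
    (ht : n * t ^ 2 ≤ 1/64) (x : Fin n → Fin 2) :
    ∑ y : Fin n → Fin K, |∏ i, emit (th K 0) (x i) (y i) - ∏ i, emit (th K t) (x i) (y i)|
      ≤ 1/2 := by
  have v0 := th_valid hK 0 le_rfl (by norm_num)
  have vt := th_valid hK t h0 h1
  set A : (Fin n → Fin K) → ℝ := fun y => ∏ i, emit (th K 0) (x i) (y i) with hA
  set R : (Fin n → Fin K) → ℝ := fun y => ∏ i, rat K t (x i) (y i) with hR
  have hA0 : ∀ y, 0 ≤ A y := fun y => Finset.prod_nonneg fun i _ => (emit_density _ v0 _).1 _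
  have hB : ∀ y : Fin n → Fin K, ∏ i, emit (th K t) (x i) (y i) = A y * R y := by
    intro y
    rw [hA, hR, ← Finset.prod_mul_distrib]
    exact Finset.prod_congr rfl fun i _ => emit_th _ _ _ _
  have sA : ∑ y, A y = 1 := by
    rw [hA, sum_pi (fun i => emit (th K 0) (x i))]
    simp [(emit_density _ v0 _).2]
  have sB : ∑ y, A y * R y = 1 := by
    simp only [← hB]
    rw [sum_pi (fun i => emit (th K t) (x i))]
    simp [(emit_density _ vt _).2]
  have sC : ∑ y, A y * R y ^ 2 = (1 + 16/3 * t^2)^n := by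
    have : ∀ y, A y * R y ^ 2 = ∏ i, (emit (th K 0) (x i) (y i) * rat K t (x i) (y i) ^ 2) := by
      intro y
      rw [Finset.prod_mul_distrib, Finset.prod_pow]
    simp only [this]
    rw [sum_pi (fun i k => emit (th K 0) (x i) k * rat K t (x i) k ^ 2)]
    simp [emit_rat_sq hK]
  have hpow : (1 + 16/3 * t^2)^n ≤ 5/4 := by
    have e1 : (1 + 16/3 * t^2)^n ≤ Real.exp (16/3*t^2) ^ n :=
      pow_le_pow_left₀ (by positivity) (by linarith [Real.add_one_le_exp (16/3*t^2)]) n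
    rw [← Real.exp_nat_mul] at e1
    have e2 : Real.exp (n * (16/3*t^2)) ≤ Real.exp (1/8) :=
      Real.exp_le_exp.2 (by nlinarith)
    have e3 : Real.exp (1/8) ≤ 5/4 := by
      have := Real.add_one_le_exp (-(1/8))
      rw [Real.exp_neg] at this
      have hp := Real.exp_pos (1/8)
      have := mul_le_mul_of_nonneg_right this hp.le
      rw [inv_mul_cancel₀ hp.ne'] at this
      linarith
    linarith
  have chi : ∑ y, A y * (1 - R y)^2 ≤ 1/4 := by
    have : ∑ y, A y * (1 - R y)^2 = ∑ y, A y - 2 * ∑ y, A y * R y + ∑ y, A y * R y ^ 2 := by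
      rw [Finset.mul_sum, ← Finset.sum_sub_distrib, ← Finset.sum_add_distrib]
      exact Finset.sum_congr rfl fun y _ => by ring
    rw [this, sA, sB, sC]; linarith
  have e : ∀ y, |A y - ∏ i, emit (th K t) (x i) (y i)| ≤ A y * (1 - R y)^2 + A y * (1/4) := by
    intro y
    rw [hB, show A y - A y * R y = A y * (1 - R y) by ring, abs_mul, abs_of_nonneg (hA0 y),
      ← mul_add]
    refine mul_le_mul_of_nonneg_left ?_ (hA0 y)
    rw [abs_le]
    constructor <;> nlinarith [sq_nonneg (1 - R y - 1/2), sq_nonneg (1 - R y + 1/2)]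
  calc _ ≤ ∑ y, (A y * (1 - R y)^2 + A y * (1/4)) := Finset.sum_le_sum fun y _ => e y
    _ ≤ 1/2 := by
      rw [Finset.sum_add_distrib, ← Finset.sum_mul, sA]; linarith

lemma l1 {K : ℕ} (hK : 2 ≤ K) (n : ℕ) (t : ℝ) (h0 : 0 ≤ t) (h1 : t ≤ 1/8)
    (ht : n * t ^ 2 ≤ 1/64) :
    ∑ y : Fin n → Fin K, |pLaw (th K 0) n y - pLaw (th K t) n y| ≤ 1/2 := by
  have v0 := th_valid hK 0 le_rfl (by norm_num)
  calc _ ≤ ∑ y : Fin n → Fin K, ∑ x, wt (th K 0) n x *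
        |∏ i, emit (th K 0) (x i) (y i) - ∏ i, emit (th K t) (x i) (y i)| := by
        refine Finset.sum_le_sum fun y _ => ?_
        rw [pLaw_eq, pLaw_eq, ← Finset.sum_sub_distrib]
        refine (Finset.abs_sum_le_sum_abs _ _).trans (Finset.sum_le_sum fun x _ => ?_)
        rw [wt_th K n t, ← mul_sub, abs_mul, abs_of_nonneg (wt_nonneg _ v0 n x)]
    _ ≤ ∑ x, wt (th K 0) n x * (1/2) := by
        rw [Finset.sum_comm]
        refine Finset.sum_le_sum fun x _ => ?_
        rw [← Finset.mul_sum]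
        exact mul_le_mul_of_nonneg_left (cond_l1 hK n t h0 h1 ht x) (wt_nonneg _ v0 n x)
    _ = 1/2 := by rw [← Finset.sum_mul, wt_sum _ v0, one_mul]

lemma two_point {K : ℕ} (hK : 2 ≤ K) (n : ℕ) (t : ℝ) (h0 : 0 ≤ t) (h1 : t ≤ 1/8)
    (ht : n * t ^ 2 ≤ 1/64) (E F : (Fin n → Fin K) → Prop) (hEF : ∀ y, E y ∨ F y) :
    1/2 ≤ probOf (th K 0) n E + probOf (th K t) n F := by
  have v0 := th_valid hK 0 le_rfl (by norm_num)
  have vt := th_valid hK t h0 h1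
  have h := l1 hK n t h0 h1 ht
  have s := pLaw_sum _ v0 n
  have : ∑ y : Fin n → Fin K, (pLaw (th K 0) n y - |pLaw (th K 0) n y - pLaw (th K t) n y|)
      ≤ probOf (th K 0) n E + probOf (th K t) n F := by
    unfold probOf
    rw [← Finset.sum_add_distrib]
    refine Finset.sum_le_sum fun y _ => ?_
    have a0 := pLaw_nonneg _ v0 n y
    have at' := pLaw_nonneg _ vt n y
    have b1 := le_abs_self (pLaw (th K 0) n y - pLaw (th K t) n y)
    have b2 := abs_nonneg (pLaw (th K 0) n y - pLaw (th K t) n y)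
    rcases hEF y with hy | hy <;> simp only [hy, if_true] <;> split_ifs <;> linarith
  rw [Finset.sum_sub_distrib, s] at this
  linarith

lemma psi_th (K : ℕ) (t : ℝ) : (psiOf (th K t)).1 = tp K (1/2 + t) (1/2 - t) := by
  funext k
  simp only [psiOf, th, tp]
  split_ifs <;> ring

lemma sep {K : ℕ} (hK : 2 ≤ K) (t r : ℝ) (g : Fin K → ℝ) (hr : 4 * r ≤ 2 * t ^ 2) :
    r ≤ (enormF fun k => g k - (psiOf (th K 0)).1 k) ^ 2 ∨
    r ≤ (enormF fun k => g k - (psiOf (th K t)).1 k) ^ 2 := by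
  by_contra! hcon
  obtain ⟨ha, hb⟩ := hcon
  rw [enormF, Real.sq_sqrt (Finset.sum_nonneg fun _ _ => sq_nonneg _)] at ha hb
  have : ∑ k, tp K (t^2) (t^2) k ≤ 2 * ∑ k, (g k - (psiOf (th K 0)).1 k)^2
      + 2 * ∑ k, (g k - (psiOf (th K t)).1 k)^2 := by
    rw [Finset.mul_sum, Finset.mul_sum, ← Finset.sum_add_distrib]
    refine Finset.sum_le_sum fun k _ => ?_
    have : tp K (t^2) (t^2) k = ((psiOf (th K t)).1 k - (psiOf (th K 0)).1 k)^2 := by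
      rw [psi_th, psi_th]
      simp only [tp]
      split_ifs <;> ring
    rw [this]
    nlinarith [sq_nonneg ((g k - (psiOf (th K 0)).1 k) + (g k - (psiOf (th K t)).1 k))]
  rw [tp_sum hK] at this
  linarith

theorem statement17 (K : ℕ) (hK : 2 ≤ K) :
    ∃ c ε₀ : ℝ, 0 < c ∧ 0 < ε₀ ∧
      ∀ (L δ ε ζ : ℝ) (n : ℕ),
        0 < L → L ≤ 1 / 3 →
        δ ∈ Set.Ioo (0 : ℝ) 1 → δ ≤ 1 / 6 →
        ε ∈ Set.Ioo (0 : ℝ) 1 → ε ≤ ε₀ →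
        0 < ζ → ζ ≤ Real.sqrt (2 * ((K / 2 : ℕ) : ℝ)) / (4 * K) →
        ∀ est : (Fin n → Fin K) → (Fin K → ℝ),
          1 / 4 ≤ ⨆ π ∈ PhiL K L δ ε ζ,
            probOf (unpack π) n (fun y =>
              c / n ≤ (enormF fun k => est y k - π.2.1 k) ^ 2) := by
  refine ⟨1/128, 1/2, by norm_num, by norm_num, ?_⟩
  intro L δ ε ζ n hL0 hL hδ0 hδ hε0 hε hζ0 hζ est
  set t : ℝ := 1 / (8 * Real.sqrt n) with htdef
  have hn : (0:ℝ) ≤ n := Nat.cast_nonneg n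
  have h0 : 0 ≤ t := by positivity
  have hsq : t ^ 2 = 1 / (64 * n) := by
    rw [htdef, div_pow, mul_pow, Real.sq_sqrt hn]; norm_num
  have h1 : t ≤ 1/8 := by
    rcases Nat.eq_zero_or_pos n with h | h
    · rw [htdef, h]; norm_num
    · have : (1:ℝ) ≤ Real.sqrt n := by
        rw [Real.one_le_sqrt]; exact_mod_cast h
      rw [htdef, div_le_div_iff₀ (by positivity) (by norm_num)]
      linarith
  have ht : n * t ^ 2 ≤ 1/64 := by
    rw [hsq]
    rcases Nat.eq_zero_or_pos n with h | h
    · rw [h]; norm_num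
    · have : (0:ℝ) < n := by exact_mod_cast h
      field_simp; norm_num
  have hr : 4 * (1/128 / (n:ℝ)) ≤ 2 * t^2 := by
    rw [hsq]
    rcases Nat.eq_zero_or_pos n with h | h
    · rw [h]; norm_num
    · have : (0:ℝ) < n := by exact_mod_cast h
      field_simp; norm_num
  set G : PP K → ℝ := fun π => ⨆ _ : π ∈ PhiL K L δ ε ζ, probOf (unpack π) n (fun y =>
              1/128 / n ≤ (enormF fun k => est y k - π.2.1 k) ^ 2) with hG
  have hle : ∀ θ ∈ ThetaL K L δ ε ζ, unpack (pack θ) = θ := fun θ hθ =>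
    unpack_pack θ hθ.1.1 (lt_of_lt_of_le hζ0 hθ.1.2.2.2.2)
  have hbdd : BddAbove (Set.range G) := by
    refine ⟨1, ?_⟩
    rintro _ ⟨π, rfl⟩
    refine Real.iSup_le (fun hπ => ?_) zero_le_one
    obtain ⟨θ, hθ, rfl⟩ := hπ
    rw [hle θ hθ]
    exact probOf_le_one θ hθ.1.1 n _
  have hth : ∀ s, 0 ≤ s → s ≤ 1/8 → probOf (th K s) n (fun y =>
              1/128 / n ≤ (enormF fun k => est y k - (psiOf (th K s)).1 k) ^ 2) ≤ ⨆ π, G π := by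
    intro s hs0 hs1
    have hm := th_mem hK s hs0 hs1 L δ ε ζ hL hδ hε hζ
    have hm' : pack (th K s) ∈ PhiL K L δ ε ζ := ⟨_, hm, rfl⟩
    have := le_ciSup hbdd (pack (th K s))
    simp only [hG] at this
    rw [ciSup_pos hm', hle _ hm] at this
    exact this
  have a := hth 0 le_rfl (by norm_num)
  have b := hth t h0 h1
  have := two_point hK n t h0 h1 ht _ _ (fun y => sep hK t (1/128 / (n:ℝ)) (est y) hr)
  change 1/4 ≤ ⨆ π, G π
  linarith

end PaperHMM
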